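/- There exist a full density subset S ⊆ 𝒩 and a function ε : S → ℝ with ε(m) → 0 as m → ∞ (m ∈ S), such that for every m ∈ S one has Σ_{n∈𝒩, n≠m} r₂(n)·(n − m)^{−2} ≤ (log m)^{1 + ε(m)}. -/

import Mathlib

open Filter Topology

noncomputable section

/-- The set of natural numbers expressible as a sum of two squares. -/
def SOS : Set ℕ := {n | ∃ x y : ℤ, (n : ℤ) = x ^ 2 + y ^ 2}

/-- `r₂(n)`, the number of representations of `n` as a sum of two squares. -/
def r2 (n : ℕ) : ℕ := Nat.card {p : ℤ × ℤ // p.1 ^ 2 + p.2 ^ 2 = (n : ℤ)}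

/-- A subset `S ⊆ 𝒩` has full density in `𝒩` if
`#{m ∈ S : m ≤ x} / #{m ∈ 𝒩 : m ≤ x} → 1` as `x → ∞`. -/
def FullDensityIn (S : Set ℕ) : Prop :=
  S ⊆ SOS ∧ Tendsto (fun x : ℕ =>
    (Nat.card {m : ℕ // m ∈ S ∧ m ≤ x} : ℝ) / (Nat.card {m : ℕ // m ∈ SOS ∧ m ≤ x} : ℝ))
    atTop (𝓝 1)


/-- Parametrisation of the positive solutions of `u * v = w * z`. -/
lemma exists_factorization_of_mul_eq_mul {u v w z : ℕ} (hu : 0 < u) (hv : 0 < v)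
    (h : u * v = w * z) :
    ∃ g k s t : ℕ, 0 < g ∧ 0 < k ∧ u = g * s ∧ w = g * t ∧ v = t * k ∧ z = s * k := by
  have hg : 0 < Nat.gcd u w := Nat.gcd_pos_of_pos_left _ hu
  obtain ⟨s, t, hst, hs, ht⟩ := Nat.exists_coprime u w
  have h1 : s * v = t * z := by
    apply Nat.eq_of_mul_eq_mul_left hg
    calc Nat.gcd u w * (s * v) = (s * Nat.gcd u w) * v := by ring
      _ = (t * Nat.gcd u w) * z := by rw [← hs, ← ht, h]
      _ = _ := by ring
  obtain ⟨k, hk⟩ : t ∣ v := hst.symm.dvd_of_dvd_mul_left (Dvd.intro _ h1.symm)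
  have ht0 : 0 < t := Nat.pos_of_ne_zero fun h0 => by simp [h0] at hk; omega
  refine ⟨Nat.gcd u w, k, s, t, hg, Nat.pos_of_ne_zero fun h0 => by simp [h0] at hk; omega,
    by rw [mul_comm]; exact hs, by rw [mul_comm]; exact ht, hk, ?_⟩
  apply Nat.eq_of_mul_eq_mul_left ht0
  rw [← h1, hk]; ring

/-- The quadruples in a box with `a ^ 2 + b ^ 2 = c ^ 2 + d ^ 2`. -/
def sqEnergy (N : ℕ) : Finset ((ℕ × ℕ) × (ℕ × ℕ)) :=
  ((Finset.range N ×ˢ Finset.range N) ×ˢ (Finset.range N ×ˢ Finset.range N)).filter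
    fun q => q.1.1 ^ 2 + q.1.2 ^ 2 = q.2.1 ^ 2 + q.2.2 ^ 2

/-- Parameters for the solutions of `u * v = w * z` in `[1, R]`. -/
def factorBox (R : ℕ) : Finset (Σ _ : ℕ × ℕ, ℕ × ℕ) :=
  (Finset.Icc 1 R ×ˢ Finset.Icc 1 R).sigma fun p =>
    Finset.Icc 1 (R / max p.1 p.2) ×ˢ Finset.Icc 1 (R / max p.1 p.2)

lemma sum_inv_max_sq_le (R : ℕ) :
    ∑ p ∈ Finset.Icc 1 R ×ˢ Finset.Icc 1 R, (((max p.1 p.2 : ℕ) : ℝ) ^ 2)⁻¹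
      ≤ 2 * (1 + Real.log R) := by
  have key : ∑ t ∈ Finset.Icc 1 R, ∑ s ∈ Finset.Icc 1 R,
      (if s ≤ t then ((t : ℝ) ^ 2)⁻¹ else 0) ≤ 1 + Real.log R := by
    calc _ = ∑ t ∈ Finset.Icc 1 R, ((t : ℝ))⁻¹ := by
          refine Finset.sum_congr rfl fun t ht => ?_
          rw [Finset.mem_Icc] at ht
          rw [← Finset.sum_filter]
          have : (Finset.Icc 1 R).filter (fun s => s ≤ t) = Finset.Icc 1 t := by
            ext s; simp; omega
          rw [this]
          have ht0 : (t : ℝ) ≠ 0 := by norm_cast; omega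
          simp
          field_simp
      _ = (harmonic R : ℝ) := by
          rw [harmonic_eq_sum_Icc]; push_cast; rfl
      _ ≤ _ := harmonic_le_one_add_log R
  calc _ ≤ ∑ p ∈ Finset.Icc 1 R ×ˢ Finset.Icc 1 R,
        ((if p.2 ≤ p.1 then ((p.1 : ℝ) ^ 2)⁻¹ else 0)
          + (if p.1 ≤ p.2 then ((p.2 : ℝ) ^ 2)⁻¹ else 0)) := by
        refine Finset.sum_le_sum fun p _ => ?_
        rcases le_total p.1 p.2 with h | h
        · rw [max_eq_right h, if_pos h]
          have : (0 : ℝ) ≤ if p.2 ≤ p.1 then ((p.1 : ℝ) ^ 2)⁻¹ else 0 := by positivity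
          linarith
        · rw [max_eq_left h, if_pos h]
          have : (0 : ℝ) ≤ if p.1 ≤ p.2 then ((p.2 : ℝ) ^ 2)⁻¹ else 0 := by positivity
          linarith
    _ ≤ _ := by
        rw [Finset.sum_add_distrib, Finset.sum_product, Finset.sum_product_right]
        linarith

lemma card_factorBox_le (R : ℕ) :
    ((factorBox R).card : ℝ) ≤ (R : ℝ) ^ 2 * (2 * (1 + Real.log R)) := by
  refine le_trans ?_ (mul_le_mul_of_nonneg_left (sum_inv_max_sq_le R) (by positivity))
  rw [factorBox, Finset.card_sigma, Finset.mul_sum]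
  push_cast
  refine Finset.sum_le_sum fun p _ => ?_
  rw [Finset.card_product, Nat.card_Icc, Nat.add_sub_cancel]
  push_cast
  have h : ((R / max p.1 p.2 : ℕ) : ℝ) ≤ R / (max p.1 p.2 : ℕ) := Nat.cast_div_le
  calc _ ≤ ((R : ℝ) / (max p.1 p.2 : ℕ)) * (R / (max p.1 p.2 : ℕ)) := by gcongr
    _ = _ := by rw [Nat.cast_max]; ring

lemma card_filter_lt_le (N : ℕ) :
    ((sqEnergy N).filter fun q => q.2.1 < q.1.1).card ≤ (factorBox (2 * N)).card := by
  refine le_trans (Finset.card_le_card ?_) (Finset.card_image_le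
    (f := fun x : Σ _ : ℕ × ℕ, ℕ × ℕ =>
      (((x.2.1 * x.1.1 + x.1.2 * x.2.2) / 2, (x.1.1 * x.2.2 - x.2.1 * x.1.2) / 2),
        ((x.1.2 * x.2.2 - x.2.1 * x.1.1) / 2, (x.2.1 * x.1.2 + x.1.1 * x.2.2) / 2))))
  rintro ⟨⟨a, b⟩, ⟨c, d⟩⟩ hq
  simp only [sqEnergy, Finset.mem_filter, Finset.mem_product, Finset.mem_range] at hq
  obtain ⟨⟨⟨⟨ha, hb⟩, hc, hd⟩, h⟩, hac⟩ := hq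
  have hbd : b < d := by
    by_contra! hdb
    nlinarith
  obtain ⟨u, rfl⟩ := Nat.exists_eq_add_of_lt hac
  obtain ⟨w, rfl⟩ := Nat.exists_eq_add_of_lt hbd
  obtain ⟨g, k, s, t, hg, hk, h1, h2, h3, h4⟩ := exists_factorization_of_mul_eq_mul
    (u := u + 1) (v := c + u + 1 + c) (w := w + 1) (z := b + w + 1 + b) (by omega) (by omega)
    (by nlinarith)
  have hs : 0 < s := Nat.pos_of_ne_zero fun h0 => by simp [h0] at h1
  have ht : 0 < t := Nat.pos_of_ne_zero fun h0 => by simp [h0] at h2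
  have hbound : ∀ i j n : ℕ, 0 < i → n = i * j → n ≤ 2 * N → j ≤ 2 * N := by
    intro i j n hi hn hn'
    exact le_trans (Nat.le_mul_of_pos_left j hi) (hn ▸ hn')
  have hs' := hbound g s _ hg h1 (by omega)
  have ht' := hbound g t _ hg h2 (by omega)
  have hm : 0 < max s t := lt_max_of_lt_left hs
  rw [Finset.mem_image]
  refine ⟨⟨(s, t), (g, k)⟩, ?_, ?_⟩
  · simp only [factorBox, Finset.mem_sigma, Finset.mem_product, Finset.mem_Icc]
    refine ⟨⟨⟨hs, hs'⟩, ht, ht'⟩, ⟨hg, ?_⟩, hk, ?_⟩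
    · rw [Nat.le_div_iff_mul_le hm]
      rcases max_choice s t with e | e <;> rw [e]
      · rw [← h1]; omega
      · rw [← h2]; omega
    · rw [Nat.le_div_iff_mul_le hm]
      rcases max_choice s t with e | e <;> rw [e, mul_comm]
      · rw [← h4]; omega
      · rw [← h3]; omega
  · simp only [← h1, ← h2, ← h3, ← h4, Prod.mk.injEq]
    omega

lemma card_sqEnergy_le (N : ℕ) :
    ((sqEnergy N).card : ℝ) ≤ (N : ℝ) ^ 2 * (1 + 16 * (1 + Real.log (2 * N))) := by
  have hlt := card_filter_lt_le N
  have hgt : ((sqEnergy N).filter fun q => q.1.1 < q.2.1).card ≤ (factorBox (2 * N)).card := by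
    refine le_trans (Finset.card_le_card_of_injOn Prod.swap ?_ Prod.swap_injective.injOn) hlt
    rintro ⟨⟨a, b⟩, ⟨c, d⟩⟩ hq
    simp only [sqEnergy, Finset.coe_filter, Finset.mem_filter, Finset.mem_product,
      Finset.mem_range, Set.mem_ofPred_eq, Prod.swap] at hq ⊢
    exact ⟨⟨⟨hq.1.1.2, hq.1.1.1⟩, hq.1.2.symm⟩, hq.2⟩
  have heq : ((sqEnergy N).filter fun q => q.1.1 = q.2.1).card ≤ N ^ 2 := by
    calc _ ≤ (Finset.range N ×ˢ Finset.range N).card := by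
          refine Finset.card_le_card_of_injOn Prod.fst ?_ ?_
          · intro q hq
            simp only [sqEnergy, Finset.coe_filter, Finset.mem_filter, Finset.mem_product,
              Set.mem_ofPred_eq] at hq
            simpa using hq.1.1.1
          · rintro ⟨⟨a, b⟩, ⟨c, d⟩⟩ hq ⟨⟨a', b'⟩, ⟨c', d'⟩⟩ hq' he
            simp only [sqEnergy, Finset.coe_filter, Finset.mem_filter, Finset.mem_product,
              Set.mem_ofPred_eq, Prod.mk.injEq] at hq hq' he ⊢
            obtain ⟨rfl, rfl⟩ := he
            have e1 := hq.1.2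
            have e2 := hq'.1.2
            rw [← hq.2] at e1 ⊢
            rw [← hq'.2] at e2 ⊢
            refine ⟨⟨rfl, rfl⟩, rfl, ?_⟩
            have : d ^ 2 = d' ^ 2 := by omega
            exact Nat.pow_left_injective (n := 2) (by norm_num) this
      _ = N ^ 2 := by simp [sq]
  have hsub : sqEnergy N ⊆ ((sqEnergy N).filter fun q => q.1.1 = q.2.1) ∪
      (((sqEnergy N).filter fun q => q.2.1 < q.1.1) ∪
        ((sqEnergy N).filter fun q => q.1.1 < q.2.1)) := by
    intro q hq
    simp only [Finset.mem_union, Finset.mem_filter, hq, true_and]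
    omega
  have hcard : (sqEnergy N).card ≤ N ^ 2 + 2 * (factorBox (2 * N)).card := by
    have h1 := Finset.card_le_card hsub
    have h2 := Finset.card_union_le ((sqEnergy N).filter fun q => q.1.1 = q.2.1)
      (((sqEnergy N).filter fun q => q.2.1 < q.1.1) ∪
        ((sqEnergy N).filter fun q => q.1.1 < q.2.1))
    have h3 := Finset.card_union_le ((sqEnergy N).filter fun q => q.2.1 < q.1.1)
        ((sqEnergy N).filter fun q => q.1.1 < q.2.1)
    omega
  have hF := card_factorBox_le (2 * N)
  have hcard' : ((sqEnergy N).card : ℝ) ≤ N ^ 2 + 2 * (factorBox (2 * N)).card := by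
    exact_mod_cast hcard
  push_cast at hF
  nlinarith

open scoped Classical in
/-- The elements of a set of natural numbers up to `x`. -/
def upTo (S : Set ℕ) (x : ℕ) : Finset ℕ := (Finset.range (x + 1)).filter (· ∈ S)

lemma mem_upTo {S : Set ℕ} {x m : ℕ} : m ∈ upTo S x ↔ m ≤ x ∧ m ∈ S := by
  simp [upTo]

lemma card_subtype_eq_card_upTo (S : Set ℕ) (x : ℕ) :
    Nat.card {m : ℕ // m ∈ S ∧ m ≤ x} = (upTo S x).card :=
  Nat.subtype_card _ fun m => by rw [mem_upTo, and_comm]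

/-- Cauchy–Schwarz lower bound for the number of sums of two squares. -/
lemma pow_four_le_card_mul_card_sqEnergy {N x : ℕ} (hx : 2 * N ^ 2 ≤ x) :
    N ^ 4 ≤ (upTo SOS x).card * (sqEnergy N).card := by
  set B := Finset.range N ×ˢ Finset.range N
  set f : ℕ × ℕ → ℕ := fun p => p.1 ^ 2 + p.2 ^ 2
  have hf : ∀ p ∈ B, f p ∈ upTo SOS x := by
    intro p hp
    simp only [B, Finset.mem_product, Finset.mem_range] at hp
    rw [mem_upTo]
    refine ⟨?_, p.1, p.2, by simp [f]⟩
    have := Nat.pow_le_pow_left hp.1.le 2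
    have := Nat.pow_le_pow_left hp.2.le 2
    simp only [f]; omega
  have hsum := Finset.card_eq_sum_card_fiberwise hf
  have hE : (sqEnergy N).card = ∑ n ∈ upTo SOS x, (B.filter fun p => f p = n).card ^ 2 := by
    rw [Finset.card_eq_sum_card_fiberwise (f := fun q => f q.1) (t := upTo SOS x)]
    · refine Finset.sum_congr rfl fun n _ => ?_
      rw [sq, ← Finset.card_product]
      congr 1
      ext q
      simp only [sqEnergy, Finset.mem_filter, Finset.mem_product, B, f]
      grind
    · intro q hq
      exact hf _ (Finset.mem_product.1 (Finset.mem_filter.1 hq).1).1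
  have hB : B.card = N ^ 2 := by simp [B, sq]
  rw [hE]
  calc N ^ 4 = (∑ n ∈ upTo SOS x, (B.filter fun p => f p = n).card) ^ 2 := by
        rw [← hsum, hB]; ring
    _ ≤ _ := sq_sum_le_card_mul_sum_sq

lemma le_card_upTo_SOS {x : ℕ} (hx : 4 ≤ x) :
    (x : ℝ) / (528 * Real.log x) ≤ (upTo SOS x).card := by
  set s := Nat.sqrt x
  have hs1 : s * s ≤ x := Nat.sqrt_le x
  have hs2 : x < (s + 1) * (s + 1) := Nat.lt_succ_sqrt x
  have hs3 : 2 ≤ s := Nat.le_sqrt.2 hx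
  obtain ⟨N, hN1, hN2⟩ : ∃ N, s ≤ 2 * N + 1 ∧ 2 * N ≤ s := ⟨s / 2, by omega, by omega⟩
  have hN : 1 ≤ N := by omega
  have hx1 : 2 * N ^ 2 ≤ x := by nlinarith
  have hx2 : x ≤ 16 * N ^ 2 := by nlinarith
  have hx3 : 2 * N ≤ x := by nlinarith
  have hlog : 1 ≤ Real.log x := by
    rw [Real.le_log_iff_exp_le (by positivity)]
    have : (4 : ℝ) ≤ x := by exact_mod_cast hx
    linarith [Real.exp_one_lt_d9]
  have hlog' : Real.log (2 * N) ≤ Real.log x :=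
    Real.log_le_log (by positivity) (by exact_mod_cast hx3)
  have hCS : (N : ℝ) ^ 4 ≤ (upTo SOS x).card * (sqEnergy N).card := by
    exact_mod_cast pow_four_le_card_mul_card_sqEnergy hx1
  have hE := card_sqEnergy_le N
  have hN0 : (0 : ℝ) < (N : ℝ) ^ 2 := by positivity
  have hE' : ((sqEnergy N).card : ℝ) ≤ N ^ 2 * (33 * Real.log x) :=
    hE.trans (by gcongr; linarith)
  have h1 : (N : ℝ) ^ 2 ≤ (upTo SOS x).card * (33 * Real.log x) := by
    have := mul_le_mul_of_nonneg_left hE' (Nat.cast_nonneg (α := ℝ) (upTo SOS x).card)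
    refine le_of_mul_le_mul_left ?_ hN0
    nlinarith
  have h2 : (x : ℝ) ≤ 16 * N ^ 2 := by exact_mod_cast hx2
  rw [div_le_iff₀ (by positivity)]
  nlinarith

lemma abs_le_sqrt_of_sq_add_sq_eq {n : ℕ} {a b : ℤ} (h : a ^ 2 + b ^ 2 = n) :
    a ∈ Finset.Icc (-(Nat.sqrt n : ℤ)) (Nat.sqrt n) := by
  have h1 : a.natAbs ≤ Nat.sqrt n := by
    rw [Nat.le_sqrt, ← Int.ofNat_le]
    push_cast
    nlinarith [sq_nonneg b, sq_abs a]
  rw [Finset.mem_Icc]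
  omega

lemma card_Icc_neg (s : ℕ) : (Finset.Icc (-(s : ℤ)) s).card = 2 * s + 1 := by
  rw [Int.card_Icc]; omega

lemma r2_le (n : ℕ) : r2 n ≤ 2 * (2 * Nat.sqrt n + 1) := by
  let f : {p : ℤ × ℤ // p.1 ^ 2 + p.2 ^ 2 = (n : ℤ)} →
      (Finset.Icc (-(Nat.sqrt n : ℤ)) (Nat.sqrt n)) × Bool :=
    fun p => (⟨p.1.1, abs_le_sqrt_of_sq_add_sq_eq p.2⟩, decide (0 ≤ p.1.2))
  have hf : Function.Injective f := by
    rintro ⟨⟨a, b⟩, h⟩ ⟨⟨a', b'⟩, h'⟩ he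
    simp only [f, Prod.mk.injEq, Subtype.mk.injEq, decide_eq_decide] at he h h' ⊢
    obtain ⟨rfl, he⟩ := he
    refine ⟨rfl, ?_⟩
    rcases sq_eq_sq_iff_eq_or_eq_neg.1 (show b ^ 2 = b' ^ 2 by linarith) with e | e <;> omega
  refine (Nat.card_le_card_of_injective f hf).trans ?_
  rw [Nat.card_prod, Nat.card_eq_fintype_card, Fintype.card_coe, card_Icc_neg]
  simp [mul_comm]

lemma sum_r2_le (x : ℕ) : ∑ n ∈ Finset.range (x + 1), r2 n ≤ (2 * Nat.sqrt x + 1) ^ 2 := by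
  have hfin : ∀ n : ℕ, Finite {p : ℤ × ℤ // p.1 ^ 2 + p.2 ^ 2 = (n : ℤ)} := fun n =>
    Set.Finite.subset (Finset.finite_toSet
      (Finset.Icc (-(Nat.sqrt n : ℤ)) (Nat.sqrt n) ×ˢ Finset.Icc (-(Nat.sqrt n : ℤ)) (Nat.sqrt n)))
      fun p hp => Finset.mem_coe.2 (Finset.mem_product.2
        ⟨abs_le_sqrt_of_sq_add_sq_eq hp, abs_le_sqrt_of_sq_add_sq_eq ((add_comm _ _).trans hp)⟩)
  set I := Finset.Icc (-(Nat.sqrt x : ℤ)) (Nat.sqrt x) with hI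
  have hmono : ∀ n ≤ x, Finset.Icc (-(Nat.sqrt n : ℤ)) (Nat.sqrt n) ⊆ I := fun n hn =>
    Finset.Icc_subset_Icc (by have := Nat.sqrt_le_sqrt hn; omega)
      (by have := Nat.sqrt_le_sqrt hn; omega)
  calc ∑ n ∈ Finset.range (x + 1), r2 n
      = ∑ n ∈ Finset.range (x + 1), ((I ×ˢ I).filter fun p => p.1 ^ 2 + p.2 ^ 2 = (n : ℤ)).card := by
        refine Finset.sum_congr rfl fun n hn => Nat.subtype_card _ fun p => ?_
        have hn' : n ≤ x := by simpa [Nat.lt_succ_iff] using hn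
        rw [Finset.mem_filter, Finset.mem_product, and_iff_right_iff_imp]
        exact fun hp => ⟨hmono n hn' (abs_le_sqrt_of_sq_add_sq_eq hp),
          hmono n hn' (abs_le_sqrt_of_sq_add_sq_eq ((add_comm _ _).trans hp))⟩
    _ ≤ (I ×ˢ I).card := by
        rw [← Finset.card_biUnion]
        · exact Finset.card_le_card (Finset.biUnion_subset.2 fun n _ => Finset.filter_subset _ _)
        · intro i _ j _ hij
          rw [Function.onFun, Finset.disjoint_left]
          intro p hp hp'
          exact hij (by
            exact_mod_cast (Finset.mem_filter.1 hp).2.symm.trans (Finset.mem_filter.1 hp').2)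
    _ = _ := by rw [Finset.card_product, hI, card_Icc_neg, sq]

lemma summable_r2_div_sq : Summable fun n : ℕ => (r2 n : ℝ) * ((n : ℝ) ^ 2)⁻¹ := by
  have h : Summable fun n : ℕ => 6 * (1 / (n : ℝ) ^ (3 / 2 : ℝ)) :=
    (Real.summable_one_div_nat_rpow.2 (by norm_num)).mul_left 6
  refine Summable.of_nonneg_of_le (fun n => by positivity) (fun n => ?_) h
  rcases Nat.eq_zero_or_pos n with rfl | hn
  · simp
  have hn0 : (0 : ℝ) < n := by exact_mod_cast hn
  have h1 : (r2 n : ℝ) ≤ 2 * (2 * Nat.sqrt n + 1) := by exact_mod_cast r2_le n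
  have h2 : (Nat.sqrt n : ℝ) ≤ √n := Real.nat_sqrt_le_real_sqrt
  have h3 : 1 ≤ √(n : ℝ) := Real.one_le_sqrt.2 (by exact_mod_cast hn)
  have h4 : (n : ℝ) ^ (3 / 2 : ℝ) * √n = n ^ 2 := by
    rw [Real.sqrt_eq_rpow, ← Real.rpow_add hn0, ← Real.rpow_natCast]; norm_num
  have h5 : (0 : ℝ) < (n : ℝ) ^ (3 / 2 : ℝ) := by positivity
  rw [← h4, mul_one_div, ← div_eq_mul_inv, div_le_div_iff₀ (by positivity) h5]
  nlinarith

/-- The tail sum at `m`; the term at `n = m` vanishes since `0⁻¹ = 0`. -/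
def tailSum (m : ℕ) : ℝ := ∑' n : ℕ, (r2 n : ℝ) * (((n : ℝ) - m) ^ 2)⁻¹

lemma tsum_ne_eq_tailSum (m : ℕ) :
    ∑' n : {n : ℕ // n ≠ m}, (r2 (n : ℕ) : ℝ) * ((((n : ℕ) : ℝ) - (m : ℝ)) ^ 2)⁻¹ = tailSum m := by
  refine tsum_subtype_eq_of_support_subset (s := {n : ℕ | n ≠ m})
    (f := fun n : ℕ => (r2 n : ℝ) * (((n : ℝ) - m) ^ 2)⁻¹) ?_
  intro n hn h
  simp [show n = m from h] at hn

lemma tailSum_nonneg (m : ℕ) : 0 ≤ tailSum m := tsum_nonneg fun n => by positivity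

lemma sum_inv_sq_sub_le (n x : ℕ) :
    ∑ m ∈ Finset.range (x + 1), (((n : ℝ) - m) ^ 2)⁻¹ ≤ ∑' k : ℤ, ((k : ℝ) ^ 2)⁻¹ := by
  have hs : Summable fun k : ℤ => ((k : ℝ) ^ 2)⁻¹ := by
    simpa using Real.summable_one_div_int_pow.2 (show 1 < 2 by norm_num)
  have := hs.sum_le_tsum ((Finset.range (x + 1)).image fun m : ℕ => (n : ℤ) - m)
    fun k _ => by positivity
  rw [Finset.sum_image (by intro a _ b _ h; simpa using h)] at this
  simpa using this

lemma sum_inv_sq_sub_le_of_lt {n x : ℕ} (h : 2 * x < n) :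
    ∑ m ∈ Finset.range (x + 1), (((n : ℝ) - m) ^ 2)⁻¹ ≤ (x + 1) * (4 * ((n : ℝ) ^ 2)⁻¹) := by
  have hn : (0 : ℝ) < n := by exact_mod_cast (by omega : 0 < n)
  calc _ ≤ ∑ m ∈ Finset.range (x + 1), 4 * ((n : ℝ) ^ 2)⁻¹ := by
        refine Finset.sum_le_sum fun m hm => ?_
        have hm' : 2 * m ≤ n := by rw [Finset.mem_range] at hm; omega
        have hm'' : 2 * (m : ℝ) ≤ n := by exact_mod_cast hm'
        calc (((n : ℝ) - m) ^ 2)⁻¹ ≤ (((n : ℝ) / 2) ^ 2)⁻¹ := by gcongr; linarith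
          _ = _ := by field_simp; norm_num
    _ = _ := by simp

/-- On average over all `m ≤ x`, the tail sum is bounded. -/
lemma exists_sum_tailSum_le :
    ∃ C : ℝ, 0 < C ∧ ∀ x : ℕ, ∑ m ∈ Finset.range (x + 1), tailSum m ≤ C * (x + 1) := by
  set D := ∑' k : ℤ, ((k : ℝ) ^ 2)⁻¹
  set A := ∑' n : ℕ, (r2 n : ℝ) * ((n : ℝ) ^ 2)⁻¹
  have hD : 0 ≤ D := tsum_nonneg fun k => by positivity
  have hA : 0 ≤ A := tsum_nonneg fun k => by positivity
  refine ⟨18 * D + 4 * A + 1, by positivity, fun x => ?_⟩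
  set h₁ : ℕ → ℝ := fun n => if n ∈ Finset.range (2 * x + 1) then D * r2 n else 0
  set h₂ : ℕ → ℝ := fun n => 4 * (x + 1) * (r2 n * ((n : ℝ) ^ 2)⁻¹)
  have hh₁ : HasSum h₁ (∑ n ∈ Finset.range (2 * x + 1), D * r2 n) := by
    have : ∑ n ∈ Finset.range (2 * x + 1), D * r2 n = ∑ n ∈ Finset.range (2 * x + 1), h₁ n :=
      Finset.sum_congr rfl fun n hn => by simp only [h₁, if_pos hn]
    rw [this]
    exact hasSum_sum_of_ne_finset_zero fun n hn => by simp only [h₁, if_neg hn]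
  have hh₂ : HasSum h₂ (4 * (x + 1) * A) := summable_r2_div_sq.hasSum.mul_left _
  have hle : ∀ n : ℕ, ∑ m ∈ Finset.range (x + 1), (r2 n : ℝ) * (((n : ℝ) - m) ^ 2)⁻¹
      ≤ h₁ n + h₂ n := by
    intro n
    have hn2 : 0 ≤ h₂ n := by positivity
    rw [← Finset.mul_sum]
    by_cases hn : n ∈ Finset.range (2 * x + 1)
    · have := mul_le_mul_of_nonneg_left (sum_inv_sq_sub_le n x) (Nat.cast_nonneg (α := ℝ) (r2 n))
      simp only [h₁, if_pos hn]
      linarith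
    · have := mul_le_mul_of_nonneg_left (sum_inv_sq_sub_le_of_lt (n := n) (x := x)
        (by rw [Finset.mem_range] at hn; omega)) (Nat.cast_nonneg (α := ℝ) (r2 n))
      simp only [h₁, h₂, if_neg hn]
      linarith
  have hsum := hh₁.summable.add hh₂.summable
  have hs : ∀ m ∈ Finset.range (x + 1),
      Summable fun n : ℕ => (r2 n : ℝ) * (((n : ℝ) - m) ^ 2)⁻¹ := fun m hm =>
    hsum.of_nonneg_of_le (fun n => by positivity) fun n => (Finset.single_le_sum
      (f := fun m : ℕ => (r2 n : ℝ) * (((n : ℝ) - m) ^ 2)⁻¹) (fun m _ => by positivity) hm).trans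
      (hle n)
  have hr : ((∑ n ∈ Finset.range (2 * x + 1), r2 n : ℕ) : ℝ) ≤ 18 * (x + 1) := by
    have h1 := sum_r2_le (2 * x)
    have h2 := Nat.sqrt_le' (2 * x)
    have h3 : (2 * Nat.sqrt (2 * x) + 1) ^ 2 ≤ 18 * (x + 1) := by nlinarith
    exact_mod_cast h1.trans h3
  calc ∑ m ∈ Finset.range (x + 1), tailSum m
      = ∑' n : ℕ, ∑ m ∈ Finset.range (x + 1), (r2 n : ℝ) * (((n : ℝ) - m) ^ 2)⁻¹ :=
        (Summable.tsum_finsetSum hs).symm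
    _ ≤ ∑' n : ℕ, (h₁ n + h₂ n) := (summable_sum hs).tsum_le_tsum hle hsum
    _ = D * (∑ n ∈ Finset.range (2 * x + 1), r2 n : ℕ) + 4 * (x + 1) * A := by
        rw [(hh₁.add hh₂).tsum_eq, ← Finset.mul_sum]; push_cast; rfl
    _ ≤ _ := by nlinarith

/-- The exponent correction for which `log m ^ (1 + ε m) = log m * log log m`. -/
def logExponent (m : ℕ) : ℝ := Real.log (Real.log (Real.log m)) / Real.log (Real.log m)

lemma tendsto_log_natCast : Tendsto (fun m : ℕ => Real.log m) atTop atTop :=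
  Real.tendsto_log_atTop.comp tendsto_natCast_atTop_atTop

lemma tendsto_logExponent : Tendsto logExponent atTop (𝓝 0) :=
  Real.isLittleO_log_id_atTop.tendsto_div_nhds_zero.comp
    (Real.tendsto_log_atTop.comp tendsto_log_natCast)

lemma rpow_one_add_log_log_div_log {y : ℝ} (hy : 1 < y) :
    y ^ (1 + Real.log (Real.log y) / Real.log y) = y * Real.log y := by
  have hy0 : 0 < y := by linarith
  have hl : 0 < Real.log y := Real.log_pos hy
  rw [Real.rpow_add hy0, Real.rpow_one, Real.rpow_def_of_pos hy0, mul_div_cancel₀ _ hl.ne',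
    Real.exp_log hl]

/-- The sums of two squares with a small tail sum. -/
def goodSet : Set ℕ := {m | m ∈ SOS ∧ tailSum m ≤ Real.log m ^ (1 + logExponent m)}

lemma goodSet_subset : goodSet ⊆ SOS := fun _ hm => hm.1

/-- Markov bound for the exceptional set. -/
lemma card_upTo_diff_le {C : ℝ}
    (hC : ∀ x : ℕ, ∑ m ∈ Finset.range (x + 1), tailSum m ≤ C * (x + 1))
    {x : ℕ} {l : ℝ} (hl : l = Real.log x / 2) (hl1 : 1 < l) :
    ((upTo SOS x \ upTo goodSet x).card : ℝ) ≤ (√x + 1) + C * (x + 1) / (l * Real.log l) := by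
  have hlog : 0 < Real.log l := Real.log_pos hl1
  have hx : (0 : ℝ) < x := by
    rcases Nat.eq_zero_or_pos x with rfl | h
    · simp at hl; linarith
    · exact_mod_cast h
  set T := (Finset.range (x + 1)).filter fun m => l * Real.log l ≤ tailSum m
  have hsub : upTo SOS x \ upTo goodSet x ⊆ Finset.range (Nat.sqrt x + 1) ∪ T := by
    intro m hm
    rw [Finset.mem_sdiff, mem_upTo, mem_upTo] at hm
    obtain ⟨⟨hmx, hmS⟩, hmG⟩ := hm
    rw [Finset.mem_union, Finset.mem_range, or_iff_not_imp_left]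
    intro hm
    have hm1 : √x ≤ m := by
      rw [Real.sqrt_le_left (by positivity)]
      have h := Nat.lt_succ_sqrt' x
      have h' : x ≤ m ^ 2 := h.le.trans (Nat.pow_le_pow_left (by omega) 2)
      exact_mod_cast h'
    have hm2 : l ≤ Real.log m := by
      rw [hl, ← Real.log_sqrt hx.le]
      exact Real.log_le_log (Real.sqrt_pos.2 hx) hm1
    have hm3 : ¬ tailSum m ≤ Real.log m ^ (1 + logExponent m) := fun h => hmG ⟨hmx, hmS, h⟩
    rw [logExponent, rpow_one_add_log_log_div_log (hl1.trans_le hm2), not_le] at hm3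
    rw [Finset.mem_filter, Finset.mem_range]
    refine ⟨by omega, le_trans ?_ hm3.le⟩
    gcongr
  have hT : (T.card : ℝ) ≤ C * (x + 1) / (l * Real.log l) := by
    rw [le_div_iff₀ (by positivity), ← nsmul_eq_mul]
    calc _ ≤ ∑ m ∈ T, tailSum m := Finset.card_nsmul_le_sum _ _ _ fun m hm =>
          (Finset.mem_filter.1 hm).2
      _ ≤ ∑ m ∈ Finset.range (x + 1), tailSum m :=
          Finset.sum_le_sum_of_subset_of_nonneg (Finset.filter_subset _ _)
            fun m _ _ => tailSum_nonneg m
      _ ≤ _ := hC x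
  have h1 : (upTo SOS x \ upTo goodSet x).card ≤ (Nat.sqrt x + 1) + T.card :=
    (Finset.card_le_card hsub).trans ((Finset.card_union_le _ _).trans (by simp))
  have h2 : ((upTo SOS x \ upTo goodSet x).card : ℝ) ≤ (Nat.sqrt x + 1) + T.card := by
    exact_mod_cast h1
  have h3 : (Nat.sqrt x : ℝ) ≤ √x := Real.nat_sqrt_le_real_sqrt
  linarith

lemma tendsto_card_diff_div_card : Tendsto (fun x : ℕ =>
    ((upTo SOS x \ upTo goodSet x).card : ℝ) / (upTo SOS x).card) atTop (𝓝 0) := by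
  obtain ⟨C, hC0, hC⟩ := exists_sum_tailSum_le
  have hhalf : Tendsto (fun x : ℕ => Real.log x / 2) atTop atTop :=
    tendsto_log_natCast.atTop_div_const (by norm_num)
  have h1 : Tendsto (fun x : ℕ => 1056 * (Real.log x / √x)) atTop (𝓝 0) := by
    have := (isLittleO_log_rpow_atTop (r := 1 / 2) (by norm_num)).tendsto_div_nhds_zero.comp
      (tendsto_natCast_atTop_atTop (R := ℝ))
    simpa [Real.sqrt_eq_rpow, Function.comp_def] using this.const_mul 1056
  have h2 : Tendsto (fun x : ℕ => 2112 * C / Real.log (Real.log x / 2)) atTop (𝓝 0) :=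
    (Real.tendsto_log_atTop.comp hhalf).const_div_atTop _
  have h3 := h1.add h2
  rw [add_zero] at h3
  refine tendsto_of_tendsto_of_tendsto_of_le_of_le' tendsto_const_nhds h3
    (Eventually.of_forall fun x => by positivity) ?_
  filter_upwards [hhalf.eventually_gt_atTop 1, eventually_ge_atTop 4] with x hl hx
  have hB := card_upTo_diff_le hC rfl hl
  have hN := le_card_upTo_SOS hx
  have hx1 : (1 : ℝ) ≤ x := by exact_mod_cast (by omega : 1 ≤ x)
  have hs1 : 1 ≤ √(x : ℝ) := Real.one_le_sqrt.2 hx1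
  have hsq : √(x : ℝ) * √x = x := Real.mul_self_sqrt (by positivity)
  have hL : 0 < Real.log x := by linarith
  have hlog : 0 < Real.log (Real.log x / 2) := Real.log_pos hl
  calc _ ≤ ((√x + √x) + C * (x + x) / (Real.log x / 2 * Real.log (Real.log x / 2)))
        / ((x : ℝ) / (528 * Real.log x)) := by
        gcongr
        refine hB.trans ?_
        gcongr
    _ = 1056 * (Real.log x * √x / x) + 2112 * C / Real.log (Real.log x / 2) := by
        field_simp
        ring
    _ = _ := by
        congr 2
        rw [div_eq_div_iff (by positivity) (by positivity), mul_assoc, hsq]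

lemma fullDensityIn_goodSet : FullDensityIn goodSet := by
  refine ⟨goodSet_subset, ?_⟩
  have h := tendsto_card_diff_div_card.const_sub 1
  rw [sub_zero] at h
  refine h.congr fun x => ?_
  rw [card_subtype_eq_card_upTo, card_subtype_eq_card_upTo]
  have hsub : upTo goodSet x ⊆ upTo SOS x := fun m hm =>
    mem_upTo.2 ⟨(mem_upTo.1 hm).1, goodSet_subset (mem_upTo.1 hm).2⟩
  have hpos : 0 < (upTo SOS x).card :=
    Finset.card_pos.2 ⟨0, mem_upTo.2 ⟨Nat.zero_le _, 0, 0, by simp⟩⟩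
  have hpos' : ((upTo SOS x).card : ℝ) ≠ 0 := by exact_mod_cast hpos.ne'
  rw [Finset.cast_card_sdiff hsub]
  field_simp
  ring

/-- On a full density subset of `𝒩`,
`∑_{n ∈ 𝒩, n ≠ m} r₂(n) (n − m)^{−2} ≤ (log m)^{1 + o(1)}`
(the summand vanishes for `n ∉ 𝒩` since then `r₂(n) = 0`). -/
theorem q_one_tail_bound :
    ∃ (S : Set ℕ) (ε : ℕ → ℝ), FullDensityIn S ∧
      Tendsto ε (atTop ⊓ 𝓟 S) (𝓝 0) ∧
      ∀ m ∈ S,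
        (∑' n : {n : ℕ // n ≠ m}, (r2 (n : ℕ) : ℝ) * ((((n : ℕ) : ℝ) - (m : ℝ)) ^ 2)⁻¹)
          ≤ Real.log m ^ (1 + ε m) := by
  refine ⟨goodSet, logExponent, fullDensityIn_goodSet, tendsto_logExponent.mono_left inf_le_left,
    fun m hm => ?_⟩
  rw [tsum_ne_eq_tailSum]
  exact hm.2
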